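/- The rank of the 2×2 matrix multiplication tensor is at least 7; that is, matrix multiplication of 2×2 complex matrices cannot be written as a sum of 6 rank-one tensors. -/

import Mathlib

open Module

theorem exists_ne_zero_forall_eq_zero_of_card_lt_finrank {K V ι : Type*} [Field K]
    [AddCommGroup V] [Module K V] [FiniteDimensional K V] (f : ι → V →ₗ[K] K) (s : Finset ι)
    (hs : s.card < finrank K V) : ∃ x ≠ 0, ∀ i ∈ s, f i x = 0 := by
  have h : LinearMap.ker (LinearMap.pi fun i : s => f i) ≠ ⊥ :=
    LinearMap.ker_ne_bot_of_finrank_lt (by simpa using hs)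
  obtain ⟨x, hx, hx0⟩ := (Submodule.ne_bot_iff _).1 h
  exact ⟨x, hx0, fun i hi => congrFun (LinearMap.mem_ker.1 hx) ⟨i, hi⟩⟩

/-- A finite family of linear forms without common zero contains a coordinate system. -/
theorem exists_basis_repr_eq_of_forall_eq_zero {K V ι : Type*} [Field K] [AddCommGroup V]
    [Module K V] [FiniteDimensional K V] [Finite ι] (f : ι → V →ₗ[K] K)
    (hf : ∀ x, (∀ i, f i x = 0) → x = 0) {n : ℕ} (hn : finrank K V = n) :
    ∃ (e : Fin n → ι) (b : Basis (Fin n) K V),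
      Function.Injective e ∧ ∀ i x, b.repr x i = f (e i) x := by
  subst hn
  obtain ⟨κ, e, he, hspan, hli⟩ := exists_linearIndependent' K f
  have : Finite κ := Finite.of_injective e he
  have := Fintype.ofFinite κ
  have hinj : Function.Injective (LinearMap.pi fun i => f (e i)) := by
    rw [injective_iff_map_eq_zero]
    intro x hx
    refine hf x fun i => ?_
    have hle : Submodule.span K (Set.range (f ∘ e)) ≤ LinearMap.ker (Dual.eval K V x) := by
      rw [Submodule.span_le]
      rintro _ ⟨i, rfl⟩
      exact congrFun hx i
    exact hle (hspan ▸ Submodule.subset_span ⟨i, rfl⟩)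
  have hcard : Fintype.card κ = finrank K V := by
    apply le_antisymm
    · have h := hli.fintype_card_le_finrank
      have h' : finrank K (V →ₗ[K] K) = finrank K V := Subspace.dual_finrank_eq
      rwa [h'] at h
    · simpa using LinearMap.finrank_le_finrank_of_injective hinj
  let g : Fin (finrank K V) ≃ κ := (Fintype.equivFinOfCardEq hcard).symm
  have hinj' : Function.Injective (LinearMap.pi fun i => f (e (g i))) := by
    intro x y hxy
    apply hinj
    ext i
    simpa using congrFun hxy (g.symm i)
  refine ⟨e ∘ g, Basis.ofEquivFun (LinearMap.linearEquivOfInjective _ hinj' (by simp)),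
    he.comp g.injective, fun i x => ?_⟩
  simp [Basis.ofEquivFun]

/-- A hyperplane of `2 × 2` matrices contains an invertible matrix. -/
theorem LinearMap.exists_apply_eq_zero_and_det_ne_zero {K : Type*} [Field K]
    {f : Matrix (Fin 2) (Fin 2) K →ₗ[K] K} (hf : f ≠ 0) : ∃ X, f X = 0 ∧ X.det ≠ 0 := by
  by_contra! h
  apply hf
  have key : ∀ x y z w : K, f !![x, y; z, w] =
      x * f !![1, 0; 0, 0] + y * f !![0, 1; 0, 0] + z * f !![0, 0; 1, 0]
        + w * f !![0, 0; 0, 1] := by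
    intro x y z w
    simp only [← smul_eq_mul, ← map_smul, ← map_add]
    congr 1
    ext i j
    fin_cases i <;> fin_cases j <;> simp
  generalize f !![1, 0; 0, 0] = a at key
  generalize f !![0, 1; 0, 0] = b at key
  generalize f !![0, 0; 1, 0] = c at key
  generalize f !![0, 0; 0, 1] = d at key
  have h' : ∀ x y z w : K, x * a + y * b + z * c + w * d = 0 → x * w - y * z = 0 := by
    intro x y z w hx
    simpa [Matrix.det_fin_two] using h !![x, y; z, w] ((key x y z w).trans hx)
  have had : a * d = 0 := by linear_combination -h' d 0 0 (-a) (by ring)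
  have hbc : b * c = 0 := by linear_combination h' 0 c (-b) 0 (by ring)
  have h0 : a = 0 ∧ b = 0 ∧ c = 0 ∧ d = 0 := by
    rcases mul_eq_zero.1 had with ha | hd <;> rcases mul_eq_zero.1 hbc with hb | hc
    · have := h' 1 0 d (-c) (by rw [ha]; ring)
      have := h' 0 1 d (-c) (by rw [hb]; ring)
      simp_all
    · have := h' 1 d 0 (-b) (by rw [ha]; ring)
      have := h' 0 d 1 (-b) (by rw [hc]; ring)
      simp_all
    · have := h' c 0 (-a) 1 (by rw [hd]; ring)
      have := h' c 1 (-a) 0 (by rw [hb]; ring)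
      simp_all
    · have := h' b (-a) 0 1 (by rw [hd]; ring)
      have := h' b (-a) 1 0 (by rw [hc]; ring)
      simp_all
  obtain ⟨rfl, rfl, rfl, rfl⟩ := h0
  ext X
  rw [Matrix.eta_fin_two X]
  simp [key]

/-- Matrices with a common left and a common right annihilator are proportional. -/
theorem Matrix.not_linearIndependent_pair_of_mul_eq_zero {K : Type*} [Field K]
    {a b Y Z : Matrix (Fin 2) (Fin 2) K} (hY : Y ≠ 0) (hZ : Z ≠ 0) (haY : a * Y = 0)
    (hbY : b * Y = 0) (hZa : Z * a = 0) (hZb : Z * b = 0) :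
    ¬ LinearIndependent K ![a, b] := by
  obtain ⟨j, hj⟩ : ∃ j, ¬ (Y 0 j = 0 ∧ Y 1 j = 0) := by
    by_contra! h
    apply hY
    ext i j
    fin_cases i <;> simp [h j]
  obtain ⟨i, hi⟩ : ∃ i, ¬ (Z i 0 = 0 ∧ Z i 1 = 0) := by
    by_contra! h
    apply hZ
    ext i j
    fin_cases j <;> simp [h i]
  have form : ∀ m : Matrix (Fin 2) (Fin 2) K, m * Y = 0 → Z * m = 0 →
      ∃ t : K, m = t • !![Z i 1 * Y 1 j, -(Z i 1 * Y 0 j); -(Z i 0 * Y 1 j), Z i 0 * Y 0 j] := by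
    intro m h1 h2
    have e1 : ∀ k, m k 0 * Y 0 j + m k 1 * Y 1 j = 0 := fun k => by
      simpa [Matrix.mul_apply] using congrFun₂ h1 k j
    have e2 : ∀ k, Z i 0 * m 0 k + Z i 1 * m 1 k = 0 := fun k => by
      simpa [Matrix.mul_apply] using congrFun₂ h2 i k
    have h10 := e1 0
    have h11 := e1 1
    have h20 := e2 0
    have h21 := e2 1
    have hex : ∃ t : K, m 0 0 = t * (Z i 1 * Y 1 j) ∧ m 0 1 = t * -(Z i 1 * Y 0 j) ∧
        m 1 0 = t * -(Z i 0 * Y 1 j) ∧ m 1 1 = t * (Z i 0 * Y 0 j) := by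
      by_cases hy : Y 0 j = 0 <;> by_cases hz : Z i 0 = 0
      · have hy' : Y 1 j ≠ 0 := fun h => hj ⟨hy, h⟩
        have hz' : Z i 1 ≠ 0 := fun h => hi ⟨hz, h⟩
        exact ⟨m 0 0 / (Z i 1 * Y 1 j), by grind⟩
      · have hy' : Y 1 j ≠ 0 := fun h => hj ⟨hy, h⟩
        exact ⟨-m 1 0 / (Z i 0 * Y 1 j), by grind⟩
      · have hz' : Z i 1 ≠ 0 := fun h => hi ⟨hz, h⟩
        exact ⟨-m 0 1 / (Z i 1 * Y 0 j), by grind⟩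
      · exact ⟨m 1 1 / (Z i 0 * Y 0 j), by grind⟩
    obtain ⟨t, m00, m01, m10, m11⟩ := hex
    refine ⟨t, ?_⟩
    ext k l
    fin_cases k <;> fin_cases l <;> simp [m00, m01, m10, m11]
  obtain ⟨s, hs⟩ := form a haY hZa
  obtain ⟨t, ht⟩ := form b hbY hZb
  rw [LinearIndependent.pair_iff]
  intro h
  obtain ⟨ht0, hs0⟩ := h t (-s) (by rw [hs, ht, smul_smul, smul_smul, ← add_smul]; simp [mul_comm])
  have ha : a = 0 := by rw [hs, neg_eq_zero.1 hs0, zero_smul]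
  simpa using (h 1 0 (by simp [ha])).1

/-- The common zeros of three of the forms `α i` have a common right annihilator. -/
theorem exists_ne_zero_forall_mul_eq_zero {K : Type*} [Field K]
    {α β : Fin 6 → (Matrix (Fin 2) (Fin 2) K →ₗ[K] K)} {c : Fin 6 → Matrix (Fin 2) (Fin 2) K}
    (h : ∀ X Y : Matrix (Fin 2) (Fin 2) K, X * Y = ∑ i, (α i X * β i Y) • c i)
    {S : Finset (Fin 6)} (hS : S.card = 3) :
    ∃ Y ≠ 0, ∀ a, (∀ i ∈ S, α i a = 0) → a * Y = 0 := by
  obtain ⟨Y, hY, hβ⟩ := exists_ne_zero_forall_eq_zero_of_card_lt_finrank β Sᶜ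
    (by simp [Finset.card_compl, hS, finrank_matrix])
  refine ⟨Y, hY, fun a ha => ?_⟩
  rw [h]
  refine Finset.sum_eq_zero fun i _ => ?_
  by_cases hi : i ∈ S
  · simp [ha i hi]
  · simp [hβ i (by simpa using hi)]

/-- The common zeros of three of the forms `α i` have a common left annihilator. -/
theorem exists_ne_zero_forall_mul_eq_zero' {K : Type*} [Field K]
    {α β : Fin 6 → (Matrix (Fin 2) (Fin 2) K →ₗ[K] K)} {c : Fin 6 → Matrix (Fin 2) (Fin 2) K}
    (h : ∀ X Y : Matrix (Fin 2) (Fin 2) K, X * Y = ∑ i, (α i X * β i Y) • c i)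
    {S : Finset (Fin 6)} (hS : S.card = 3) :
    ∃ Z ≠ 0, ∀ a, (∀ i ∈ S, α i a = 0) → Z * a = 0 := by
  obtain ⟨Z, hZ, hc⟩ := exists_ne_zero_forall_eq_zero_of_card_lt_finrank
    (fun i => Matrix.traceLinearMap (Fin 2) K K ∘ₗ LinearMap.mulRight K (c i)) Sᶜ
    (by simp [Finset.card_compl, hS, finrank_matrix])
  refine ⟨Z, hZ, fun a ha => ?_⟩
  refine Matrix.ext_iff_trace_mul_right.2 fun Y => ?_
  rw [mul_assoc, h a Y, Finset.mul_sum, Matrix.trace_sum, zero_mul, Matrix.trace_zero]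
  refine Finset.sum_eq_zero fun i _ => ?_
  by_cases hi : i ∈ S
  · simp [ha i hi]
  · have htr : (Z * c i).trace = 0 := hc i (by simpa using hi)
    rw [Matrix.mul_smul, Matrix.trace_smul, htr, smul_zero]

theorem det_eq_zero_of_forall_eq_zero {K : Type*} [Field K]
    {α β : Fin 6 → (Matrix (Fin 2) (Fin 2) K →ₗ[K] K)} {c : Fin 6 → Matrix (Fin 2) (Fin 2) K}
    (h : ∀ X Y : Matrix (Fin 2) (Fin 2) K, X * Y = ∑ i, (α i X * β i Y) • c i)
    {S : Finset (Fin 6)} (hS : S.card = 3)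
    {a : Matrix (Fin 2) (Fin 2) K} (ha : ∀ i ∈ S, α i a = 0) : a.det = 0 := by
  obtain ⟨Y, hY, hmul⟩ := exists_ne_zero_forall_mul_eq_zero h hS
  by_contra hdet
  refine hY ?_
  rw [← Matrix.nonsing_inv_mul_cancel_left a Y (isUnit_iff_ne_zero.2 hdet), hmul a ha, mul_zero]

theorem not_linearIndependent_pair_of_forall_eq_zero {K : Type*} [Field K]
    {α β : Fin 6 → (Matrix (Fin 2) (Fin 2) K →ₗ[K] K)} {c : Fin 6 → Matrix (Fin 2) (Fin 2) K}
    (h : ∀ X Y : Matrix (Fin 2) (Fin 2) K, X * Y = ∑ i, (α i X * β i Y) • c i)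
    {S : Finset (Fin 6)} (hS : S.card = 3)
    {a b : Matrix (Fin 2) (Fin 2) K} (ha : ∀ i ∈ S, α i a = 0) (hb : ∀ i ∈ S, α i b = 0) :
    ¬ LinearIndependent K ![a, b] := by
  obtain ⟨Y, hY, hY'⟩ := exists_ne_zero_forall_mul_eq_zero h hS
  obtain ⟨Z, hZ, hZ'⟩ := exists_ne_zero_forall_mul_eq_zero' h hS
  exact Matrix.not_linearIndependent_pair_of_mul_eq_zero hY hZ (hY' a ha) (hY' b hb)
    (hZ' a ha) (hZ' b hb)

/-- The multiplication of `2 × 2` matrices over any field has rank at least `7`. -/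
theorem false_of_mul_eq_sum_six {K : Type*} [Field K]
    {α β : Fin 6 → (Matrix (Fin 2) (Fin 2) K →ₗ[K] K)} {c : Fin 6 → Matrix (Fin 2) (Fin 2) K}
    (h : ∀ X Y : Matrix (Fin 2) (Fin 2) K, X * Y = ∑ i, (α i X * β i Y) • c i) : False := by
  have hα : ∀ X, (∀ i, α i X = 0) → X = 0 := fun X hX => by
    simpa [hX] using h X 1
  obtain ⟨e, b, he, hb⟩ := exists_basis_repr_eq_of_forall_eq_zero α hα
    (n := 4) (by simp [finrank_matrix])
  obtain ⟨m, hm⟩ : ∃ m, ∀ k, e k ≠ m := by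
    by_contra! hsurj
    simpa using Fintype.card_le_of_surjective e hsurj
  have hαb : ∀ k i, α (e k) (b i) = if i = k then 1 else 0 := fun k i => by
    rw [← hb, b.repr_self, Finsupp.single_apply]
  have hcard : ∀ i j, i ≠ j → (insert m (Finset.image e {i, j}ᶜ)).card = 3 := fun i j hij => by
    rw [Finset.card_insert_of_notMem (by simpa using fun k _ _ => hm k),
      Finset.card_image_of_injective _ he, Finset.card_compl, Finset.card_pair hij]
    rfl
  have hvanish : ∀ i j X, α m X = 0 → (∀ k, k ≠ i → k ≠ j → α (e k) X = 0) →
      ∀ n ∈ insert m (Finset.image e {i, j}ᶜ), α n X = 0 := fun i j X hX hk => by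
    simp only [Finset.forall_mem_insert, Finset.forall_mem_image]
    exact ⟨hX, fun k hkij => hk k (by simp_all) (by simp_all)⟩
  have hdetb : ∀ i, (b i).det = 0 := by
    intro i
    have hS : (Finset.image e {i}ᶜ).card = 3 := by
      rw [Finset.card_image_of_injective _ he, Finset.card_compl, Finset.card_singleton]
      rfl
    refine det_eq_zero_of_forall_eq_zero h hS ?_
    simp only [Finset.forall_mem_image, Finset.mem_compl, Finset.mem_singleton, hαb]
    exact fun k hk => if_neg (Ne.symm hk)
  have hpair : ∀ i j, i ≠ j → α m (b i) = 0 → α m (b j) ≠ 0 := by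
    intro i j hij hi hj
    refine not_linearIndependent_pair_of_forall_eq_zero h (hcard i j hij) (a := b i) (b := b j)
      (hvanish i j _ hi ?_) (hvanish i j _ hj ?_) ?_
    · exact fun k hki _ => by rw [hαb, if_neg hki.symm]
    · exact fun k _ hkj => by rw [hαb, if_neg hkj.symm]
    · have hli := b.linearIndependent.comp ![i, j] (by
        intro x y
        fin_cases x <;> fin_cases y <;> simp [hij, hij.symm])
      have hcomp : b ∘ ![i, j] = ![b i, b j] := by
        ext x : 1
        fin_cases x <;> rfl
      rw [hcomp] at hli
      exact hli
  have hpolar : ∀ i j, i ≠ j → α m (b i) ≠ 0 → α m (b j) ≠ 0 →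
      (b i) 0 0 * (b j) 1 1 + (b j) 0 0 * (b i) 1 1
        - (b i) 0 1 * (b j) 1 0 - (b j) 0 1 * (b i) 1 0 = 0 := by
    intro i j hij hi hj
    have hd : (α m (b j) • b i - α m (b i) • b j).det = 0 := by
      refine det_eq_zero_of_forall_eq_zero h (hcard i j hij) (hvanish i j _ ?_ ?_)
      · simp [mul_comm]
      · intro k hki hkj
        simp [hαb, hki.symm, hkj.symm]
    have hi' := hdetb i
    have hj' := hdetb j
    simp only [Matrix.det_fin_two, Matrix.sub_apply, Matrix.smul_apply, smul_eq_mul]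
      at hd hi' hj'
    refine (mul_eq_zero.1 ?_).resolve_left (mul_ne_zero hi hj)
    linear_combination α m (b j) ^ 2 * hi' + α m (b i) ^ 2 * hj' - hd
  obtain ⟨l, hl⟩ : ∃ l, ∀ i, i ≠ l → α m (b i) ≠ 0 := by
    by_cases h0 : ∃ l, α m (b l) = 0
    · obtain ⟨l, hl⟩ := h0
      exact ⟨l, fun i hi => hpair l i hi.symm hl⟩
    · push Not at h0
      exact ⟨0, fun i _ => h0 i⟩
  have hαl : α (e l) ≠ 0 := fun h0 => by
    have := hαb l l
    simp [h0] at this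
  obtain ⟨X, hX, hdet⟩ := LinearMap.exists_apply_eq_zero_and_det_ne_zero hαl
  have hmul : ∀ i j, i ≠ j → b.repr X i * b.repr X j *
      ((b i) 0 0 * (b j) 1 1 + (b j) 0 0 * (b i) 1 1
        - (b i) 0 1 * (b j) 1 0 - (b j) 0 1 * (b i) 1 0) = 0 := by
    intro i j hij
    by_cases hi : i = l
    · rw [hi, hb l, hX, zero_mul, zero_mul]
    · by_cases hj : j = l
      · rw [hj, hb l, hX, mul_zero, zero_mul]
      · rw [hpolar i j hij (hl i hi) (hl j hj), mul_zero]
  refine hdet ?_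
  have d0 := hdetb 0
  have d1 := hdetb 1
  have d2 := hdetb 2
  have d3 := hdetb 3
  rw [← b.sum_repr X]
  simp only [Matrix.det_fin_two, Fin.sum_univ_four, Matrix.add_apply, Matrix.smul_apply,
    smul_eq_mul] at d0 d1 d2 d3 ⊢
  linear_combination b.repr X 0 ^ 2 * d0 + b.repr X 1 ^ 2 * d1 + b.repr X 2 ^ 2 * d2
    + b.repr X 3 ^ 2 * d3 + hmul 0 1 (by decide) + hmul 0 2 (by decide) + hmul 0 3 (by decide)
    + hmul 1 2 (by decide) + hmul 1 3 (by decide) + hmul 2 3 (by decide)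

/-- 2×2 matrix multiplication cannot be written as a sum of 6 rank-one tensors. -/
theorem stmt4 :
    ¬ ∃ (α β : Fin 6 → (Matrix (Fin 2) (Fin 2) ℂ →ₗ[ℂ] ℂ))
        (c : Fin 6 → Matrix (Fin 2) (Fin 2) ℂ),
      ∀ X Y : Matrix (Fin 2) (Fin 2) ℂ, X * Y = ∑ i, (α i X * β i Y) • c i := by
  rintro ⟨α, β, c, h⟩
  exact false_of_mul_eq_sum_six h
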